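/- Let w : [−π/2, π/2] → ℝ be a nonnegative Lipschitz function with w(−π/2) = w(π/2) = 0, which satisfies w'' + w ≥ 0 on (−π/2, π/2) in the sense of distributions. Then w(x) = a cos x where a = max of w on [−π/2, π/2]. -/

import Mathlib

open Real Set MeasureTheory

open scoped Convolution in
/-- Mollification of a Lipschitz function. -/
lemma mollify_aux (W : ℝ → ℝ) (K : NNReal) (hW : LipschitzWith K W) (ε : ℝ) (hε : 0 < ε) :
    ∃ ρ f f1 f2 : ℝ → ℝ, ContDiff ℝ (⊤ : ℕ∞) ρ ∧ (∀ x, 0 ≤ ρ x) ∧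
      Function.support ρ = Metric.ball 0 ε ∧
      (∀ x, HasDerivAt f (f1 x) x) ∧ (∀ x, HasDerivAt f1 (f2 x) x) ∧
      (∀ x, |f x - W x| ≤ K * ε) ∧ (∀ x, |f1 x| ≤ K) ∧
      (∀ x, f2 x + f x = ∫ t, W t * (deriv (deriv ρ) (x - t) + ρ (x - t))) := by
  let b : ContDiffBump (0 : ℝ) := ⟨ε / 2, ε, by positivity, by linarith⟩
  let ρ : ℝ → ℝ := b.normed volume
  have hρs : ContDiff ℝ (⊤ : ℕ∞) ρ := b.contDiff_normed
  have hρc : HasCompactSupport ρ := b.hasCompactSupport_normed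
  have hρ1s : ContDiff ℝ (⊤ : ℕ∞) (deriv ρ) := by
    have := (contDiff_infty_iff_deriv (𝕜 := ℝ) (f := ρ)).1 hρs
    exact this.2
  have hρ2s : ContDiff ℝ (⊤ : ℕ∞) (deriv (deriv ρ)) := by
    have := (contDiff_infty_iff_deriv (𝕜 := ℝ) (f := deriv ρ)).1 hρ1s
    exact this.2
  have hWi : LocallyIntegrable W volume := hW.continuous.locallyIntegrable
  have hex : ∀ (g : ℝ → ℝ), HasCompactSupport g → Continuous g → ∀ x,
      Integrable (fun t => g (x - t) * W t) := by
    intro g hg hgc x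
    apply Continuous.integrable_of_hasCompactSupport
    · exact (hgc.comp (by fun_prop)).mul hW.continuous
    · apply HasCompactSupport.mul_right
      exact hg.comp_homeomorph (Homeomorph.subLeft x)
  let L := ContinuousLinearMap.lsmul ℝ ℝ (E := ℝ)
  have hd1 : ∀ x, HasDerivAt (ρ ⋆[L, volume] W) ((deriv ρ ⋆[L, volume] W) x) x := fun x =>
    hρc.hasDerivAt_convolution_left L (hρs.of_le (by simp)) hWi x
  have hd2 : ∀ x, HasDerivAt (deriv ρ ⋆[L, volume] W) ((deriv (deriv ρ) ⋆[L, volume] W) x) x :=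
    fun x => hρc.deriv.hasDerivAt_convolution_left L (hρ1s.of_le (by simp)) hWi x
  have hlip : LipschitzWith K (ρ ⋆[L, volume] W) := by
    apply LipschitzWith.of_dist_le_mul
    intro x y
    have hi : ∀ z, Integrable (fun t => ρ t * W (z - t)) := by
      intro z
      apply Continuous.integrable_of_hasCompactSupport
      · exact hρs.continuous.mul (hW.continuous.comp (by fun_prop))
      · exact hρc.mul_right
    have e : ∀ z, (ρ ⋆[L, volume] W) z = ∫ t, ρ t * W (z - t) := fun z => rfl
    rw [dist_eq_norm, e, e, ← integral_sub (hi x) (hi y)]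
    have := norm_integral_le_of_norm_le (f := fun t => ρ t * W (x - t) - ρ t * W (y - t))
      (g := fun t => ρ t * (K * dist x y))
      ((b.integrable_normed (μ := volume)).mul_const _) (by
        refine Filter.Eventually.of_forall fun t => ?_
        rw [← mul_sub, norm_mul, Real.norm_of_nonneg (b.nonneg_normed t)]
        refine mul_le_mul_of_nonneg_left ?_ (b.nonneg_normed t)
        have h := hW.dist_le_mul (x - t) (y - t)
        rwa [dist_eq_norm, dist_sub_right] at h)
    refine this.trans_eq ?_
    rw [integral_mul_const]
    have : ∫ t, ρ t = 1 := b.integral_normed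
    rw [this, one_mul]
  refine ⟨ρ, ρ ⋆[L, volume] W, deriv ρ ⋆[L, volume] W, deriv (deriv ρ) ⋆[L, volume] W,
    hρs, b.nonneg_normed, b.support_normed_eq, hd1, hd2, ?_, ?_, ?_⟩
  · intro x
    refine b.dist_normed_convolution_le (μ := volume) hW.continuous.aestronglyMeasurable ?_
    intro y hy
    refine (hW.dist_le_mul y x).trans ?_
    exact mul_le_mul_of_nonneg_left (le_of_lt hy) K.2
  · intro x
    have := norm_deriv_le_of_lipschitz (x₀ := x) hlip
    rwa [(hd1 x).deriv] at this
  · intro x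
    rw [convolution_lsmul_swap, convolution_lsmul_swap, ← integral_add]
    · congr 1; ext t; simp only [smul_eq_mul]; ring
    · exact hex _ hρc.deriv.deriv hρ2s.continuous x
    · exact hex _ hρc hρs.continuous x

/-- The differential inequality for smooth functions. -/
lemma ode_aux (f f1 f2 : ℝ → ℝ) (h1 : ∀ x, HasDerivAt f (f1 x) x)
    (h2 : ∀ x, HasDerivAt f1 (f2 x) x) (c M : ℝ) (hc : c < π / 2)
    (hpos : ∀ x ∈ Icc (-c) c, 0 ≤ f2 x + f x)
    (hM1 : |f1 (-c) * cos (-c) + f (-c) * sin (-c)| ≤ M)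
    (hM2 : |f1 c * cos c + f c * sin c| ≤ M) (x : ℝ) (hx : |x| ≤ c) :
    |f x / cos x - f 0| ≤ M / cos x ^ 2 * |x| := by
  have hc0 : 0 ≤ c := (abs_nonneg x).trans hx
  have hu : ∀ y, HasDerivAt (fun y => f1 y * cos y + f y * sin y) ((f2 y + f y) * cos y) y := by
    intro y
    convert! ((h2 y).mul (hasDerivAt_cos y)).add ((h1 y).mul (hasDerivAt_sin y)) using 1
    ring
  have hmono : MonotoneOn (fun y => f1 y * cos y + f y * sin y) (Icc (-c) c) := by
    apply monotoneOn_of_deriv_nonneg (convex_Icc _ _)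
    · exact fun y _ => (hu y).continuousAt.continuousWithinAt
    · exact fun y _ => (hu y).differentiableAt.differentiableWithinAt
    · intro y hy
      have hy := interior_subset hy
      rw [(hu y).deriv]
      exact mul_nonneg (hpos y hy) (cos_nonneg_of_mem_Icc ⟨by linarith [hy.1], by linarith [hy.2]⟩)
  have hb : ∀ y ∈ Icc (-c) c, |f1 y * cos y + f y * sin y| ≤ M := by
    intro y hy
    have a1 := hmono (left_mem_Icc.2 (by linarith)) hy hy.1
    have a2 := hmono hy (right_mem_Icc.2 (by linarith)) hy.2
    simp only at a1 a2
    rw [abs_le] at *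
    constructor <;> linarith
  have hM : 0 ≤ M := (abs_nonneg _).trans hM2
  have hxp : 0 < cos x := cos_pos_of_mem_Ioo ⟨by linarith [neg_abs_le x], by linarith [le_abs_self x]⟩
  have hcos : ∀ y ∈ Icc (-|x|) |x|, cos x ≤ cos y := by
    intro y hy
    rw [← cos_abs x, ← cos_abs y]
    exact cos_le_cos_of_nonneg_of_le_pi (abs_nonneg _) (by linarith [pi_pos]) (abs_le.2 hy)
  have key := Convex.norm_image_sub_le_of_norm_hasDerivWithin_le
    (f := fun y => f y / cos y) (f' := fun y => (f1 y * cos y + f y * sin y) / cos y ^ 2)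
    (s := Icc (-|x|) |x|) (C := M / cos x ^ 2) (x := 0) (y := x) ?_ ?_ (convex_Icc _ _)
    ⟨by simp, by simp⟩ ⟨neg_abs_le x, le_abs_self x⟩
  · simpa using key
  · intro y hy
    have := hcos y hy
    have h := (h1 y).div (hasDerivAt_cos y) (by linarith : 0 < cos y).ne'
    convert! h.hasDerivWithinAt using 1
    ring
  · intro y hy
    have := hcos y hy
    rw [norm_div, Real.norm_eq_abs, Real.norm_of_nonneg (sq_nonneg (cos y))]
    have := hb y ⟨by linarith [hy.1], by linarith [hy.2]⟩
    gcongr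

theorem stmt_11 (w : ℝ → ℝ) (K : NNReal)
    (hlip : LipschitzOnWith K w (Set.Icc (-(Real.pi / 2)) (Real.pi / 2)))
    (hnonneg : ∀ x ∈ Set.Icc (-(Real.pi / 2)) (Real.pi / 2), 0 ≤ w x)
    (hbd₁ : w (-(Real.pi / 2)) = 0) (hbd₂ : w (Real.pi / 2) = 0)
    (hdistrib : ∀ φ : ℝ → ℝ, ContDiff ℝ (⊤ : ℕ∞) φ → (∀ x, 0 ≤ φ x) →
      Function.support φ ⊆ Set.Ioo (-(Real.pi / 2)) (Real.pi / 2) →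
      0 ≤ ∫ x in Set.Icc (-(Real.pi / 2)) (Real.pi / 2),
        w x * (deriv (deriv φ) x + φ x)) :
    ∃ a : ℝ, IsGreatest (w '' Set.Icc (-(Real.pi / 2)) (Real.pi / 2)) a ∧
      ∀ x ∈ Set.Icc (-(Real.pi / 2)) (Real.pi / 2), w x = a * Real.cos x := by
  have hpi := pi_pos
  have hle : -(π / 2) ≤ π / 2 := by linarith
  let W : ℝ → ℝ := fun x => w (projIcc _ _ hle x)
  have hWl : LipschitzWith K W := by
    have h := (hlip.to_restrict).comp (LipschitzWith.projIcc hle)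
    rwa [mul_one] at h
  have hWw : ∀ x ∈ Icc (-(π / 2)) (π / 2), W x = w x := by
    intro x hx
    simp only [W, projIcc_of_mem hle hx]
  have hW0 : ∀ x, x ∉ Icc (-(π / 2)) (π / 2) → W x = 0 := by
    intro x hx
    rcases lt_or_ge x (-(π / 2)) with h | h
    · simp only [W, projIcc_of_le_left hle h.le, hbd₁]
    · have h' : π / 2 ≤ x := by
        by_contra h'
        exact hx ⟨h, by linarith⟩
      simp only [W, projIcc_of_right_le hle h', hbd₂]
  have hint : ∀ g : ℝ → ℝ, ∫ t, W t * g t = ∫ t in Icc (-(π / 2)) (π / 2), w t * g t := by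
    intro g
    rw [← setIntegral_eq_integral_of_forall_compl_eq_zero (s := Icc (-(π / 2)) (π / 2))]
    · exact setIntegral_congr_fun measurableSet_Icc fun t ht => by simp only [hWw t ht]
    · intro t ht
      rw [hW0 t ht, zero_mul]
  have main : ∀ x, |x| < π / 2 → W x = W 0 * cos x := by
    intro x hx
    have hxp : 0 < cos x :=
      cos_pos_of_mem_Ioo ⟨by linarith [neg_abs_le x], by linarith [le_abs_self x]⟩
    have hest : ∀ ε, 0 < ε → ε ≤ π / 2 - |x| →
        |W x / cos x - W 0| ≤ (3 * K / cos x ^ 2 * |x| + K / cos x + K) * ε := by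
      intro ε hε hεx
      obtain ⟨ρ, f, f1, f2, hρs, hρn, hρsupp, hf1, hf2, hfW, hf1K, hfe⟩ :=
        mollify_aux W K hWl ε hε
      have hK : (0 : ℝ) ≤ K := K.2
      have hcos : |cos (π / 2 - ε)| ≤ ε := by
        rw [cos_pi_div_two_sub]
        exact (abs_sin_le_abs).trans (abs_of_pos hε).le
      have hW1 : |W (π / 2 - ε)| ≤ K * ε := by
        have := hWl.dist_le_mul (π / 2 - ε) (π / 2)
        rw [hWw (π / 2) ⟨hle, le_rfl⟩, hbd₂, Real.dist_eq, Real.dist_eq] at this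
        simpa [abs_of_pos hε] using this
      have hW2 : |W (-(π / 2 - ε))| ≤ K * ε := by
        have := hWl.dist_le_mul (-(π / 2 - ε)) (-(π / 2))
        rw [hWw (-(π / 2)) ⟨le_rfl, hle⟩, hbd₁, Real.dist_eq, Real.dist_eq] at this
        have e : -(π / 2 - ε) - -(π / 2) = ε := by ring
        rwa [e, abs_of_pos hε, sub_zero] at this
      have gen : ∀ z, |cos z| ≤ ε → |W z| ≤ K * ε → |f1 z * cos z + f z * sin z| ≤ 3 * K * ε := by
        intro z hz hWz
        have a1 : |f z| ≤ 2 * K * ε := by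
          have := abs_add_le (f z - W z) (W z)
          rw [sub_add_cancel] at this
          linarith [hfW z]
        have a2 : |f1 z * cos z| ≤ K * ε := by
          rw [abs_mul]
          exact mul_le_mul (hf1K z) hz (abs_nonneg _) hK
        have a3 : |f z * sin z| ≤ 2 * K * ε := by
          rw [abs_mul]
          exact (mul_le_of_le_one_right (abs_nonneg _) (abs_sin_le_one z)).trans a1
        linarith [abs_add_le (f1 z * cos z) (f z * sin z)]
      have hode := ode_aux f f1 f2 hf1 hf2 (π / 2 - ε) (3 * K * ε) (by linarith) ?_
        (gen _ (by rwa [cos_neg]) hW2) (gen _ hcos hW1) x (by linarith)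
      · have b1 : |(W x - f x) / cos x| ≤ K * ε / cos x := by
          rw [abs_div, abs_of_pos hxp, abs_sub_comm]
          gcongr
          exact hfW x
        have b2 := hfW 0
        have e : W x / cos x - W 0 = (W x - f x) / cos x + (f x / cos x - f 0) + (f 0 - W 0) := by
          ring
        rw [e]
        refine (abs_add_three _ _ _).trans ?_
        refine (add_le_add (add_le_add b1 hode) b2).trans_eq ?_
        ring
      · intro y hy
        have hd := hdistrib (fun t => ρ (y - t)) (hρs.comp (by fun_prop)) (fun t => hρn _) ?_
        · rw [hfe, hint]
          convert hd using 5 with t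
          have e1 : deriv (fun t => ρ (y - t)) = fun t => - deriv ρ (y - t) := by
            ext s; exact deriv_comp_const_sub ρ y s
          rw [e1, deriv.fun_neg, deriv_comp_const_sub (deriv ρ) y t, neg_neg]
        · intro t ht
          have : y - t ∈ Function.support ρ := ht
          rw [hρsupp, mem_ball_zero_iff, Real.norm_eq_abs, abs_lt] at this
          exact ⟨by linarith [hy.1], by linarith [hy.2]⟩
    have hz : |W x / cos x - W 0| ≤ 0 := by
      have ht : Filter.Tendsto (fun ε : ℝ => (3 * K / cos x ^ 2 * |x| + K / cos x + K) * ε)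
          (nhdsWithin 0 (Ioi 0)) (nhds 0) := by
        have : Continuous (fun ε : ℝ => (3 * K / cos x ^ 2 * |x| + K / cos x + K) * ε) := by
          fun_prop
        have h := this.tendsto 0
        rw [mul_zero] at h
        exact h.mono_left nhdsWithin_le_nhds
      refine ge_of_tendsto ht ?_
      filter_upwards [Ioc_mem_nhdsGT (show (0 : ℝ) < π / 2 - |x| by linarith)] with ε hε
      exact hest ε hε.1 hε.2
    have h0 : W x / cos x - W 0 = 0 := abs_eq_zero.1 (le_antisymm hz (abs_nonneg _))
    field_simp at h0
    linarith
  have h0mem : (0 : ℝ) ∈ Icc (-(π / 2)) (π / 2) := ⟨by linarith, by linarith⟩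
  have fin : ∀ x ∈ Icc (-(π / 2)) (π / 2), w x = w 0 * cos x := by
    intro x hx
    rcases lt_or_eq_of_le (abs_le.2 hx) with h | h
    · rw [← hWw x hx, ← hWw 0 h0mem]
      exact main x h
    · rcases (abs_eq (by linarith)).1 h with h | h
      · rw [h, hbd₂, cos_pi_div_two, mul_zero]
      · rw [h, hbd₁, cos_neg, cos_pi_div_two, mul_zero]
  refine ⟨w 0, ⟨⟨0, h0mem, rfl⟩, ?_⟩, fin⟩
  rintro _ ⟨x, hx, rfl⟩
  rw [fin x hx]
  exact mul_le_of_le_one_right (hnonneg 0 h0mem) (cos_le_one x)
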